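/- With the fixed-pair setup in a diregular (2,k,+3)-digraph with k ≥ 3: if v₁ ∉ O(u), then O(u) = {v, v₃, v₄}; similarly, if u₁ ∉ O(v), then O(v) = {u, u₃, u₄}. -/

import Mathlib

/-- `p` is a directed walk from `u` to `v` in the digraph with arc relation `A`,
recorded as the list of its vertices; a walk of length `l` (i.e. with `l` arcs)
is a list of `l + 1` vertices. -/
def IsWalkFrom {V : Type*} (A : V → V → Prop) (u v : V) (p : List V) : Prop :=
  p.Chain' A ∧ p.head? = some u ∧ p.getLast? = some v

/-- A digraph is `k`-geodetic if for every ordered pair of vertices `(u, v)`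
there is at most one directed path of length at most `k` from `u` to `v`. -/
def IsKGeodetic {V : Type*} (A : V → V → Prop) (k : ℕ) : Prop :=
  ∀ (u v : V) (p q : List V), IsWalkFrom A u v p → IsWalkFrom A u v q →
    p.length ≤ k + 1 → q.length ≤ k + 1 → p = q

/-- `Nout A u = N⁺(u)`, the set of out-neighbours of `u`. -/
def Nout {V : Type*} (A : V → V → Prop) (u : V) : Set V := {v | A u v}

/-- `Nin A u = N⁻(u)`, the set of in-neighbours of `u`. -/
def Nin {V : Type*} (A : V → V → Prop) (u : V) : Set V := {v | A v u}

/-- `NIter A l u = N^l(u)`, the set of vertices reachable from `u` by a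
directed path of length exactly `l`. -/
def NIter {V : Type*} (A : V → V → Prop) (l : ℕ) (u : V) : Set V :=
  {v | ∃ p : List V, IsWalkFrom A u v p ∧ p.length = l + 1}

/-- `Ball A l u = T_l(u) = N^0(u) ∪ N^1(u) ∪ ⋯ ∪ N^l(u)`, the set of vertices
at distance at most `l` from `u`. -/
def Ball {V : Type*} (A : V → V → Prop) (l : ℕ) (u : V) : Set V :=
  {v | ∃ m ≤ l, v ∈ NIter A m u}

/-- `Outliers A k u = O(u) = {v | d(u,v) ≥ k + 1}`, the outlier set of `u`. -/
def Outliers {V : Type*} (A : V → V → Prop) (k : ℕ) (u : V) : Set V :=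
  {v | v ∉ Ball A k u}

/-- A digraph is diregular with degree `d` if every vertex has out-degree `d`
and in-degree `d`. -/
def IsDiregular {V : Type*} (A : V → V → Prop) (d : ℕ) : Prop :=
  ∀ u : V, (Nout A u).ncard = d ∧ (Nin A u).ncard = d

/-- The Moore bound `M(d,k) = 1 + d + d² + ⋯ + d^k`. -/
def moore (d k : ℕ) : ℕ := ∑ i ∈ Finset.range (k + 1), d ^ i

section Walks

variable {V : Type*} {A : V → V → Prop} {k : ℕ}

theorem mem_NIter_zero {u w : V} : w ∈ NIter A 0 u ↔ w = u := by
  constructor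
  · rintro ⟨p, ⟨-, hhead, hlast⟩, hlen⟩
    obtain ⟨a, rfl⟩ := List.length_eq_one_iff.mp hlen
    simp_all
  · rintro rfl
    exact ⟨[w], ⟨by simp [List.Chain'], rfl, rfl⟩, rfl⟩

theorem IsWalkFrom.cons {u x w : V} {p : List V} (h : A u x) (hp : IsWalkFrom A x w p) :
    IsWalkFrom A u w (u :: p) := by
  obtain ⟨hc, hh, hl⟩ := hp
  cases p with
  | nil => simp at hh
  | cons a p =>
    simp only [List.head?_cons, Option.some.injEq] at hh
    subst hh
    exact ⟨List.IsChain.cons_cons h hc, rfl, by simpa using hl⟩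

theorem mem_NIter_succ {m : ℕ} {u w : V} :
    w ∈ NIter A (m + 1) u ↔ ∃ x, A u x ∧ w ∈ NIter A m x := by
  constructor
  · rintro ⟨p, ⟨hc, hh, hl⟩, hlen⟩
    match p, hc, hh, hl, hlen with
    | a :: b :: p, hc, hh, hl, hlen =>
      simp only [List.head?_cons, Option.some.injEq] at hh
      subst hh
      simp only [List.Chain', List.isChain_cons_cons] at hc
      exact ⟨b, hc.1, b :: p, ⟨hc.2, rfl, by simpa using hl⟩, by simpa using hlen⟩
  · rintro ⟨x, hx, p, hp, hlen⟩
    exact ⟨u :: p, hp.cons hx, by simp [hlen]⟩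

theorem NIter_cons {m : ℕ} {u x w : V} (h : A u x) (hw : w ∈ NIter A m x) :
    w ∈ NIter A (m + 1) u :=
  mem_NIter_succ.mpr ⟨x, h, hw⟩

theorem NIter_trans {a b : ℕ} {u x w : V} (h : x ∈ NIter A a u) (hw : w ∈ NIter A b x) :
    w ∈ NIter A (a + b) u := by
  induction a generalizing u with
  | zero => rw [mem_NIter_zero.mp h] at hw; simpa using hw
  | succ a ih =>
    obtain ⟨y, hy, hxy⟩ := mem_NIter_succ.mp h
    rw [Nat.add_right_comm]
    exact NIter_cons hy (ih hxy)

theorem mem_NIter_one {u w : V} : w ∈ NIter A 1 u ↔ A u w := by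
  simp [mem_NIter_succ, mem_NIter_zero]

theorem IsKGeodetic.length_unique (hgeo : IsKGeodetic A k) {m n : ℕ} {u w : V}
    (hm : w ∈ NIter A m u) (hn : w ∈ NIter A n u) (hmk : m ≤ k) (hnk : n ≤ k) : m = n := by
  obtain ⟨p, hp, hpl⟩ := hm
  obtain ⟨q, hq, hql⟩ := hn
  have := hgeo u w p q hp hq (by omega) (by omega)
  subst this
  omega

theorem IsKGeodetic.first_step_unique (hgeo : IsKGeodetic A k) {m n : ℕ} {u x y w : V}
    (hx : A u x) (hy : A u y) (hm : w ∈ NIter A m x) (hn : w ∈ NIter A n y)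
    (hmk : m + 1 ≤ k) (hnk : n + 1 ≤ k) : x = y := by
  obtain ⟨p, hp, hpl⟩ := hm
  obtain ⟨q, hq, hql⟩ := hn
  have h := hgeo u w (u :: p) (u :: q) (hp.cons hx) (hq.cons hy)
    (by simp; omega) (by simp; omega)
  have h2 : p = q := by simpa using h
  have h3 := hp.2.1
  rw [h2, hq.2.1] at h3
  simpa using h3.symm

theorem NIter_succ_eq_union {m : ℕ} {u x y : V} (h : Nout A u = {x, y}) :
    NIter A (m + 1) u = NIter A m x ∪ NIter A m y := by
  have hA (z : V) : A u z ↔ z = x ∨ z = y := by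
    change z ∈ Nout A u ↔ _
    simp [h]
  ext w
  simp [mem_NIter_succ, hA]

theorem IsDiregular.ncard_NIter [Finite V] (hreg : IsDiregular A 2) (hgeo : IsKGeodetic A k)
    {m : ℕ} (hm : m ≤ k) (u : V) : (NIter A m u).ncard = 2 ^ m := by
  induction m generalizing u with
  | zero =>
    have : NIter A 0 u = {u} := by ext; simp [mem_NIter_zero]
    simp [this]
  | succ m ih =>
    obtain ⟨x, y, hxy, h⟩ := Set.ncard_eq_two.mp (hreg u).1
    have hx : x ∈ Nout A u := by simp [h]
    have hy : y ∈ Nout A u := by simp [h]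
    rw [NIter_succ_eq_union h, Set.ncard_union_eq, ih (by omega), ih (by omega)]
    · ring
    · rw [Set.disjoint_left]
      exact fun w hwx hwy => hxy (hgeo.first_step_unique hx hy hwx hwy hm hm)

theorem IsDiregular.ncard_Ball [Finite V] (hreg : IsDiregular A 2) (hgeo : IsKGeodetic A k)
    {l : ℕ} (hl : l ≤ k) (u : V) : (Ball A l u).ncard = moore 2 l := by
  induction l with
  | zero =>
    have : Ball A 0 u = {u} := by ext; simp [Ball, mem_NIter_zero]
    simp [this, moore]
  | succ l ih =>
    have h : Ball A (l + 1) u = Ball A l u ∪ NIter A (l + 1) u := by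
      ext w
      constructor
      · rintro ⟨m, hm, hw⟩
        rcases Nat.lt_or_eq_of_le hm with hlt | rfl
        · exact Or.inl ⟨m, by omega, hw⟩
        · exact Or.inr hw
      · rintro (⟨m, hm, hw⟩ | hw)
        · exact ⟨m, by omega, hw⟩
        · exact ⟨l + 1, le_rfl, hw⟩
    rw [h, Set.ncard_union_eq, ih (by omega), hreg.ncard_NIter hgeo hl, moore, moore,
      Finset.sum_range_succ _ (l + 1)]
    rw [Set.disjoint_left]
    rintro w ⟨m, hm, hw⟩ hw'
    have := hgeo.length_unique hw hw' (by omega) hl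
    omega

theorem IsDiregular.ncard_Outliers [Fintype V] (hreg : IsDiregular A 2)
    (hgeo : IsKGeodetic A k) {ε : ℕ} (hcard : Fintype.card V = moore 2 k + ε) (u : V) :
    (Outliers A k u).ncard = ε := by
  have h := Set.ncard_add_ncard_compl (Ball A k u)
  rw [hreg.ncard_Ball hgeo le_rfl, Nat.card_eq_fintype_card, hcard] at h
  change (Ball A k u)ᶜ.ncard = ε
  omega

theorem outliers_eq_of_not_mem_outliers [Fintype V]
    {u v u₁ u₂ v₁ v₃ v₄ : V}
    (hreg : IsDiregular A 2) (hgeo : IsKGeodetic A k)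
    (hcard : Fintype.card V = moore 2 k + 3)
    (hu : Nout A u = {u₁, u₂}) (hv : Nout A v = {v₁, u₂}) (huv : u₁ ≠ v₁)
    (hv₁ : Nout A v₁ = {v₃, v₄}) (hk : 3 ≤ k) (hout : v₁ ∉ Outliers A k u) :
    Outliers A k u = {v, v₃, v₄} := by
  have ne_of_pair {x a b : V} (h : Nout A x = {a, b}) : a ≠ b := by
    rintro rfl
    have := (hreg x).1
    simp [h] at this
  have hu12 := ne_of_pair hu
  have hv12 := ne_of_pair hv
  have hv34 := ne_of_pair hv₁
  have auu₁ : A u u₁ := by change u₁ ∈ Nout A u; simp [hu]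
  have auu₂ : A u u₂ := by change u₂ ∈ Nout A u; simp [hu]
  have avv₁ : A v v₁ := by change v₁ ∈ Nout A v; simp [hv]
  have avu₂ : A v u₂ := by change u₂ ∈ Nout A v; simp [hv]
  have av₃ : A v₁ v₃ := by change v₃ ∈ Nout A v₁; simp [hv₁]
  have av₄ : A v₁ v₄ := by change v₄ ∈ Nout A v₁; simp [hv₁]
  have hvu : v ≠ u := by
    rintro rfl
    have h : u₁ ∈ ({v₁, u₂} : Set V) := by rw [← hv, hu]; simp
    rcases h with h | h
    · exact huv h
    · exact hu12 h
  have self (x : V) : x ∈ NIter A 0 x := mem_NIter_zero.mpr rfl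
  obtain ⟨t, htk, ht⟩ : ∃ t, t + 1 ≤ k ∧ v₁ ∈ NIter A t u₁ := by
    have h : v₁ ∈ Ball A k u := not_not.mp hout
    obtain ⟨j, hj, hw⟩ := h
    rcases j with _ | i
    · rw [mem_NIter_zero] at hw
      subst hw
      exact absurd (hgeo.first_step_unique avv₁ avu₂ (mem_NIter_one.mpr auu₂) (self u₂)
        (by omega) (by omega)) hv12
    · rw [NIter_succ_eq_union hu] at hw
      rcases hw with hw | hw
      · exact ⟨i, hj, hw⟩
      · exact absurd (hgeo.first_step_unique avv₁ avu₂ (self v₁) hw (by omega) hj) hv12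
  have ht0 : t ≠ 0 := by
    rintro rfl
    exact huv (mem_NIter_zero.mp ht).symm
  have hvO : v ∈ Outliers A k u := by
    rintro ⟨j, hj, hw⟩
    rcases j with _ | i
    · exact hvu (mem_NIter_zero.mp hw)
    · rw [NIter_succ_eq_union hu] at hw
      rcases hw with hw | hw
      · have := hgeo.length_unique ht (NIter_trans hw (mem_NIter_one.mpr avv₁))
          (by omega) hj
        exact hu12 (hgeo.first_step_unique auu₁ auu₂
          (NIter_trans hw (mem_NIter_one.mpr avu₂)) (self u₂) (by omega) (by omega))
      · have := hgeo.length_unique (NIter_trans hw (mem_NIter_one.mpr avu₂)) (self u₂)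
          hj (by omega)
        omega
  obtain ⟨m, hm⟩ : ∃ m, t + m = k := ⟨k - t, by omega⟩
  have hsub : ∀ w ∈ NIter A m v₁, w ≠ v ∧ (w ≠ u → w ∈ Outliers A k u) := by
    intro w hw
    constructor
    · rintro rfl
      have := hgeo.length_unique (NIter_cons avv₁ hw) (self w) (by omega) (by omega)
      omega
    · rintro hwu ⟨j, hj, hwj⟩
      rcases j with _ | i
      · exact hwu (mem_NIter_zero.mp hwj)
      · rw [NIter_succ_eq_union hu] at hwj
        rcases hwj with hwj | hwj
        · have := hgeo.length_unique hwj (NIter_trans ht hw) (by omega) (by omega)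
          omega
        · exact hv12 (hgeo.first_step_unique avv₁ avu₂ hw hwj (by omega) hj)
  have hO := hreg.ncard_Outliers hgeo hcard u
  have hm1 : m = 1 := by
    by_contra hne
    have h2 : 2 ^ 2 ≤ 2 ^ m := Nat.pow_le_pow_right (by omega) (by omega)
    have hN := hreg.ncard_NIter hgeo (show m ≤ k by omega) v₁
    have hle : (NIter A m v₁).ncard ≤ (insert u (Outliers A k u \ {v})).ncard := by
      refine Set.ncard_le_ncard ?_ (Set.toFinite _)
      intro w hw
      obtain ⟨h, h'⟩ := hsub w hw
      by_cases hwu : w = u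
      · exact Or.inl hwu
      · exact Or.inr ⟨h' hwu, h⟩
    have hins := Set.ncard_insert_le u (Outliers A k u \ {v})
    rw [Set.ncard_sdiff_singleton_of_mem hvO] at hins
    omega
  subst hm1
  have out_mem {w : V} (hw : A v₁ w) : w ∈ Outliers A k u := by
    refine (hsub w (mem_NIter_one.mpr hw)).2 ?_
    rintro rfl
    exact hv12 (hgeo.first_step_unique avv₁ avu₂ (NIter_cons hw (mem_NIter_one.mpr auu₂))
      (self u₂) (by omega) (by omega))
  have hv3 := (hsub v₃ (mem_NIter_one.mpr av₃)).1
  have hv4 := (hsub v₄ (mem_NIter_one.mpr av₄)).1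
  symm
  refine Set.eq_of_subset_of_ncard_le ?_ ?_ (Set.toFinite _)
  · rintro w (rfl | rfl | rfl)
    · exact hvO
    · exact out_mem av₃
    · exact out_mem av₄
  · rw [hO, Set.ncard_eq_three.mpr ⟨v, v₃, v₄, hv3.symm, hv4.symm, hv34, rfl⟩]

end Walks

/-- Fixed-pair setup, `k ≥ 3`: if `v₁ ∉ O(u)` then `O(u) = {v, v₃, v₄}`,
and if `u₁ ∉ O(v)` then `O(v) = {u, u₃, u₄}`. -/
theorem outliers_when_v1_not_outlier {V : Type*} [Fintype V] (A : V → V → Prop) (k : ℕ)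
    (u v u₁ u₂ v₁ : V)
    (hirr : Irreflexive A) (hreg : IsDiregular A 2) (hgeo : IsKGeodetic A k)
    (hcard : Fintype.card V = moore 2 k + 3)
    (hu : Nout A u = {u₁, u₂}) (hv : Nout A v = {v₁, u₂}) (huv : u₁ ≠ v₁)
    (u₃ u₄ v₃ v₄ : V)
    (hu₁ : Nout A u₁ = {u₃, u₄}) (hv₁ : Nout A v₁ = {v₃, v₄})
    (hk : 3 ≤ k) :
    (v₁ ∉ Outliers A k u → Outliers A k u = {v, v₃, v₄}) ∧
      (u₁ ∉ Outliers A k v → Outliers A k v = {u, u₃, u₄}) := by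
  exact ⟨outliers_eq_of_not_mem_outliers hreg hgeo hcard hu hv huv hv₁ hk,
    outliers_eq_of_not_mem_outliers hreg hgeo hcard hv hu huv.symm hu₁ hk⟩
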